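/- arXiv:1007.3037 — 2 statements merged into one kernel-verified Lean document; each statement's English description precedes it below -/
import Mathlib

section
/- There exist constants c, C > 0 and an integer N such that for every integer n ≥ N there exists a maximal K_4-free simple graph G on n vertices in which every vertex has degree at least c·n^(3/5)·(log n)^(1/5) and at most C·n^(3/5)·(log n)^(1/5); in particular, the number of edges of G is at least (c/2)·n^(8/5)·(log n)^(1/5) and at most (C/2)·n^(8/5)·(log n)^(1/5). -/
/-- The rook graph of a `q × q` board, each cell of which carries the nine labels in
`ZMod 3 × ZMod 3`: vertices in the same row must differ in the row label, vertices in the same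
column must differ in the column label, and adjacent vertices share a row or a column. -/
def labelledRookGraph (q : ℕ) : SimpleGraph ((Fin q × ZMod 3) × (Fin q × ZMod 3)) where
  Adj s t := (s.1.1 = t.1.1 ∨ s.2.1 = t.2.1) ∧
    (s.1.1 = t.1.1 → s.1.2 ≠ t.1.2) ∧ (s.2.1 = t.2.1 → s.2.2 ≠ t.2.2)
  symm := ⟨by grind⟩
  loopless := ⟨by grind⟩

lemma forall_eq_or_forall_eq_of_pairwise {ι α β : Type*} (r : ι → α) (c : ι → β)
    (h : ∀ i j, r i = r j ∨ c i = c j) : (∀ i j, r i = r j) ∨ (∀ i j, c i = c j) := by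
  by_contra! hne
  obtain ⟨⟨i, j, hij⟩, k, l, hkl⟩ := hne
  have := h i j; have := h k l; have := h i k; have := h i l; have := h j k; have := h j l
  grind

lemma labelledRookGraph_not_pairwise_adj (q : ℕ)
    (t : Fin 4 → (Fin q × ZMod 3) × (Fin q × ZMod 3))
    (h : ∀ i j, i ≠ j → (labelledRookGraph q).Adj (t i) (t j)) : False := by
  have no_inj (a : Fin 4 → ZMod 3) : ¬ Function.Injective a := fun ha => by
    simpa using Fintype.card_le_of_injective a ha
  rcases forall_eq_or_forall_eq_of_pairwise (fun i => (t i).1.1) (fun i => (t i).2.1)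
    (fun i j => by
      by_cases hij : i = j
      · exact Or.inl (by rw [hij])
      · exact (h i j hij).1) with hr | hc
  · refine no_inj (fun i => (t i).1.2) fun i j hij => ?_
    by_contra hne
    exact (h i j hne).2.1 (hr i j) hij
  · refine no_inj (fun i => (t i).2.2) fun i j hij => ?_
    by_contra hne
    exact (h i j hne).2.2 (hc i j) hij

lemma cliqueFree_comap_labelledRookGraph {V : Type*} {q : ℕ}
    (f : V → (Fin q × ZMod 3) × (Fin q × ZMod 3)) :
    ((labelledRookGraph q).comap f).CliqueFree 4 := by
  by_contra hc
  obtain ⟨g⟩ := (SimpleGraph.not_cliqueFree_iff_top_isContained 4).1 hc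
  exact labelledRookGraph_not_pairwise_adj q (fun i => f (g i)) fun i j hij =>
    g.toHom.map_adj (by simpa using hij)

lemma not_cliqueFree_four_of_adj {V : Type*} {G : SimpleGraph V} {u v x y : V}
    (huv : G.Adj u v) (hux : G.Adj u x) (huy : G.Adj u y) (hvx : G.Adj v x)
    (hvy : G.Adj v y) (hxy : G.Adj x y) : ¬ G.CliqueFree 4 := by
  classical
  refine SimpleGraph.IsNClique.not_cliqueFree (s := {u, v, x, y}) ?_
  have h3 : G.IsNClique 3 {v, x, y} := SimpleGraph.is3Clique_triple_iff.2 ⟨hvx, hvy, hxy⟩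
  exact h3.insert (by simp [huv, hux, huy])

/-- In a `K₄`-free graph containing a blow-up of the labelled rook graph without empty classes,
adjacent vertices lie over a common row or a common column. -/
lemma eq_or_eq_of_adj_of_comap_labelledRookGraph_le {V : Type*} {q : ℕ}
    {f : V → (Fin q × ZMod 3) × (Fin q × ZMod 3)} (hf : Function.Surjective f)
    {G : SimpleGraph V} (hG : G.CliqueFree 4) (hle : (labelledRookGraph q).comap f ≤ G)
    {u v : V} (huv : G.Adj u v) : (f u).1.1 = (f v).1.1 ∨ (f u).2.1 = (f v).2.1 := by
  by_contra! hne
  obtain ⟨hr, hc⟩ := hne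
  obtain ⟨x, hx⟩ := hf (((f u).1.1, (f u).1.2 + 1), ((f v).2.1, (f v).2.2 + 1))
  obtain ⟨y, hy⟩ := hf (((f u).1.1, (f u).1.2 + 2), ((f v).2.1, (f v).2.2 + 2))
  have h2 : (2 : ZMod 3) ≠ 0 := by decide
  have h12 : ∀ a : ZMod 3, a + 1 ≠ a + 2 := by decide
  refine not_cliqueFree_four_of_adj huv (hle ?_) (hle ?_) (hle ?_) (hle ?_) (hle ?_) hG
    (x := x) (y := y) <;>
  simp [labelledRookGraph, hx, hy, h2, h12, hc, hr.symm]

lemma exists_maximal_cliqueFree_ge {V : Type*} [Finite V] {m : ℕ} {H : SimpleGraph V}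
    (hH : H.CliqueFree m) : ∃ G, H ≤ G ∧ G.CliqueFree m ∧ ∀ a b, a ≠ b → ¬ G.Adj a b →
      ¬ (G ⊔ SimpleGraph.fromEdgeSet {s(a, b)}).CliqueFree m := by
  obtain ⟨G, hHG, hG⟩ := Finite.exists_le_maximal (p := fun G : SimpleGraph V => G.CliqueFree m) hH
  refine ⟨G, hHG, hG.prop, fun a b hab hadj hfree => hadj ?_⟩
  refine hG.le_of_ge hfree le_sup_left ?_
  simp [hab]

lemma card_filter_fin_mod_eq (n m r : ℕ) (hr : r < m) :
    n / m ≤ (Finset.univ.filter fun i : Fin n => (i : ℕ) % m = r).card ∧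
      (Finset.univ.filter fun i : Fin n => (i : ℕ) % m = r).card ≤ n / m + 1 := by
  have h : (Finset.univ.filter fun i : Fin n => (i : ℕ) % m = r).card
      = n.count (· ≡ r [MOD m]) := by
    simp only [Nat.count_eq_card_filter_range, Finset.card_filter, Finset.sum_range, Nat.ModEq,
      Nat.mod_eq_of_lt hr]
  rw [h, Nat.count_modEq_card _ (by omega)]
  split_ifs <;> omega

lemma exists_balanced_map (n : ℕ) (α : Type*) [Fintype α] [DecidableEq α] [Nonempty α] :
    ∃ f : Fin n → α, ∀ a, n / Fintype.card α ≤ (Finset.univ.filter fun i => f i = a).card ∧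
      (Finset.univ.filter fun i => f i = a).card ≤ n / Fintype.card α + 1 := by
  have e := Fintype.equivFin α
  refine ⟨fun i => e.symm ⟨i % Fintype.card α, Nat.mod_lt _ Fintype.card_pos⟩, fun a => ?_⟩
  simpa [Equiv.symm_apply_eq, Fin.ext_iff] using
    card_filter_fin_mod_eq n (Fintype.card α) (e a) (e a).2

lemma exists_maximal_K4_free_of_card {n q : ℕ} (hq : 0 < q) (hn : 9 * q ^ 2 ≤ n) :
    ∃ G : SimpleGraph (Fin n), G.CliqueFree 4 ∧
      (∀ a b : Fin n, a ≠ b → ¬ G.Adj a b →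
        ¬ (G ⊔ SimpleGraph.fromEdgeSet {s(a, b)}).CliqueFree 4) ∧
      ∀ v : Fin n, n / (9 * q ^ 2) * (6 * (q - 1)) ≤ (G.neighborSet v).ncard ∧
        (G.neighborSet v).ncard ≤ (n / (9 * q ^ 2) + 1) * (18 * q) := by
  classical
  have : NeZero q := ⟨hq.ne'⟩
  have hcard : Fintype.card ((Fin q × ZMod 3) × (Fin q × ZMod 3)) = 9 * q ^ 2 := by
    simp; ring
  obtain ⟨f, hf⟩ := exists_balanced_map n ((Fin q × ZMod 3) × (Fin q × ZMod 3))
  rw [hcard] at hf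
  have hpos : 0 < n / (9 * q ^ 2) := Nat.div_pos hn (by positivity)
  have hsurj : Function.Surjective f := fun a => by
    obtain ⟨i, hi⟩ := Finset.card_pos.1 (hpos.trans_le (hf a).1)
    exact ⟨i, (Finset.mem_filter.1 hi).2⟩
  obtain ⟨G, hle, hfree, hmax⟩ :=
    exists_maximal_cliqueFree_ge (cliqueFree_comap_labelledRookGraph f)
  refine ⟨G, hfree, hmax, fun v => ?_⟩
  rw [Set.ncard_eq_toFinset_card']
  constructor
  · let S : Finset ((Fin q × ZMod 3) × (Fin q × ZMod 3)) :=
      ({(f v).1.1} ×ˢ {(f v).1.2}ᶜ) ×ˢ ({(f v).2.1}ᶜ ×ˢ Finset.univ)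
    have hS : S.card = 6 * (q - 1) := by
      simp [S, Finset.card_compl]; ring
    have hsub : (Finset.univ.filter fun u => f u ∈ S) ⊆ (G.neighborSet v).toFinset := by
      intro u hu
      simp only [S, Finset.mem_filter, Finset.mem_product, Finset.mem_singleton,
        Finset.mem_compl, Finset.mem_univ, true_and, and_true] at hu
      obtain ⟨⟨h1, h2⟩, h3⟩ := hu
      rw [Set.mem_toFinset]
      exact hle ⟨Or.inl h1.symm, fun _ => Ne.symm h2, fun h => absurd h.symm h3⟩
    refine le_trans ?_ (Finset.card_le_card hsub)
    rw [← hS]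
    refine Finset.mul_card_image_le_card_of_maps_to (f := f)
      (fun u hu => (Finset.mem_filter.1 hu).2) _ fun b hb => (hf b).1.trans ?_
    refine Finset.card_le_card fun u hu => ?_
    simp only [Finset.mem_filter, Finset.mem_univ, true_and] at hu ⊢
    exact ⟨hu ▸ hb, hu⟩
  · let S : Finset ((Fin q × ZMod 3) × (Fin q × ZMod 3)) :=
      ({(f v).1.1} ×ˢ Finset.univ) ×ˢ Finset.univ ∪
        Finset.univ ×ˢ ({(f v).2.1} ×ˢ Finset.univ)
    have hS : S.card ≤ 18 * q := by
      refine (Finset.card_union_le _ _).trans ?_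
      simp; linarith
    refine le_trans ?_ (Nat.mul_le_mul_left _ hS)
    refine Finset.card_le_mul_card_image_of_maps_to (f := f) (fun u hu => ?_) _ fun b _ =>
      (Finset.card_le_card (Finset.filter_subset_filter _ (Finset.subset_univ _))).trans (hf b).2
    rw [Set.mem_toFinset] at hu
    rcases eq_or_eq_of_adj_of_comap_labelledRookGraph_le hsurj hfree hle hu with h | h <;>
      simp [S, h]

lemma two_mul_ncard_edgeSet_eq_sum_ncard_neighborSet {V : Type*} [Fintype V] (G : SimpleGraph V) :
    2 * G.edgeSet.ncard = ∑ v, (G.neighborSet v).ncard := by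
  classical
  rw [← SimpleGraph.coe_edgeFinset, Set.ncard_coe_finset, ← G.sum_degrees_eq_twice_card_edges]
  simp [Set.ncard_eq_toFinset_card', SimpleGraph.degree, SimpleGraph.neighborFinset]

/-- The board size `q` is the integer part of `X = n / D` where
`D = n ^ (3 / 5) * (log n) ^ (1 / 5)` is the target degree. -/
lemma exists_board_size {n : ℕ} (hn : 59049 ≤ n) : ∃ q : ℕ, 2 ≤ q ∧ 9 * q ^ 2 ≤ n ∧
    (n : ℝ) / q ≤ 2 * ((n : ℝ) ^ ((3 : ℝ) / 5) * Real.log n ^ ((1 : ℝ) / 5)) ∧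
    (n : ℝ) ^ ((3 : ℝ) / 5) * Real.log n ^ ((1 : ℝ) / 5) ≤ n / q := by
  have hn' : (59049 : ℝ) ≤ n := by exact_mod_cast hn
  have hn0 : (0 : ℝ) < n := by linarith
  have hlog1 : 1 ≤ Real.log n := by
    rw [Real.le_log_iff_exp_le hn0]
    linarith [Real.exp_one_lt_d9]
  have hlogn : Real.log n ≤ n := Real.log_le_self hn0.le
  set a : ℝ := (n : ℝ) ^ ((1 : ℝ) / 5) with ha
  set l : ℝ := Real.log n ^ ((1 : ℝ) / 5) with hl
  have ha9 : 9 ≤ a := by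
    have : (9 : ℝ) = (59049 : ℝ) ^ ((1 : ℝ) / 5) := by
      rw [show (59049 : ℝ) = 9 ^ (5 : ℝ) by norm_num, ← Real.rpow_mul (by norm_num)]
      norm_num
    rw [this]
    exact Real.rpow_le_rpow (by norm_num) hn' (by norm_num)
  have hl1 : 1 ≤ l := Real.one_le_rpow hlog1 (by norm_num)
  have hla : l ≤ a := Real.rpow_le_rpow (by linarith) hlogn (by norm_num)
  have hna : (n : ℝ) = a ^ 5 := by
    rw [ha, ← Real.rpow_mul_natCast hn0.le]; norm_num
  have hna3 : (n : ℝ) ^ ((3 : ℝ) / 5) = a ^ 3 := by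
    rw [ha, ← Real.rpow_mul_natCast hn0.le]; norm_num
  have hX : a ≤ a ^ 2 / l := by
    rw [le_div_iff₀ (by positivity)]; nlinarith
  have hq1 : ((⌊a ^ 2 / l⌋₊ : ℕ) : ℝ) ≤ a ^ 2 / l := Nat.floor_le (by positivity)
  have hq2 : a ^ 2 / l < ⌊a ^ 2 / l⌋₊ + 1 := Nat.lt_floor_add_one _
  have hq3 : 2 ≤ ⌊a ^ 2 / l⌋₊ := Nat.le_floor (by push_cast; linarith)
  rw [hna3]
  generalize ⌊a ^ 2 / l⌋₊ = q at hq1 hq2 hq3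
  have hq0 : (0 : ℝ) < q := by
    have : (2 : ℝ) ≤ q := by exact_mod_cast hq3
    linarith
  refine ⟨q, hq3, ?_, ?_, ?_⟩
  · have h1 : (q : ℝ) ≤ a ^ 2 := hq1.trans (div_le_self (by positivity) hl1)
    have h2 : (9 * q ^ 2 : ℝ) ≤ n := by
      rw [hna]
      calc (9 * q ^ 2 : ℝ) ≤ a * (a ^ 2) ^ 2 := by gcongr
        _ = a ^ 5 := by ring
    exact_mod_cast h2
  · have h1 : a ^ 2 / l ≤ 2 * q := by linarith
    rw [div_le_iff₀ (by linarith)] at h1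
    rw [div_le_iff₀ hq0, hna]
    calc a ^ 5 = a ^ 3 * a ^ 2 := by ring
      _ ≤ a ^ 3 * (2 * q * l) := by gcongr
      _ = _ := by ring
  · rw [le_div_iff₀ (by linarith)] at hq1
    rw [le_div_iff₀ hq0, hna]
    calc a ^ 3 * l * q = a ^ 3 * (q * l) := by ring
      _ ≤ a ^ 3 * a ^ 2 := by gcongr
      _ = a ^ 5 := by ring

lemma board_degree_bounds {n q d : ℕ} (hq : 2 ≤ q) (hn : 9 * q ^ 2 ≤ n)
    (hlow : n / (9 * q ^ 2) * (6 * (q - 1)) ≤ d) (hupp : d ≤ (n / (9 * q ^ 2) + 1) * (18 * q)) :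
    (1 / 6 : ℝ) * (n / q) ≤ d ∧ (d : ℝ) ≤ 4 * (n / q) := by
  have hpos : 0 < 9 * q ^ 2 := by positivity
  have h1 : n / (9 * q ^ 2) * (9 * q ^ 2) ≤ n := Nat.div_mul_le_self _ _
  have h2 : n < (n / (9 * q ^ 2) + 1) * (9 * q ^ 2) := (Nat.div_lt_iff_lt_mul hpos).1 (Nat.lt_succ_self _)
  have h3 : 1 ≤ n / (9 * q ^ 2) := Nat.div_pos hn hpos
  generalize n / (9 * q ^ 2) = k at *
  obtain ⟨p, rfl⟩ : ∃ p, q = p + 1 := ⟨q - 1, by omega⟩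
  simp only [Nat.add_sub_cancel] at hlow
  have hp : (1 : ℝ) ≤ p := by exact_mod_cast (by omega : 1 ≤ p)
  have hk : (1 : ℝ) ≤ k := by exact_mod_cast h3
  have h1' : (k : ℝ) * (9 * (p + 1) ^ 2) ≤ n := by exact_mod_cast h1
  have h2' : (n : ℝ) ≤ (k + 1) * (9 * (p + 1) ^ 2) := by exact_mod_cast h2.le
  have hlow' : (k : ℝ) * (6 * p) ≤ d := by exact_mod_cast hlow
  have hupp' : (d : ℝ) ≤ (k + 1) * (18 * (p + 1)) := by exact_mod_cast hupp
  push_cast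
  constructor
  · refine le_trans ?_ hlow'
    rw [← mul_div_assoc, div_le_iff₀ (by positivity)]
    calc (1 / 6 : ℝ) * n ≤ 1 / 6 * ((k + k) * (9 * (p + p) * (p + 1))) := by
          gcongr; refine h2'.trans ?_; rw [pow_two, ← mul_assoc 9]; gcongr
      _ = k * (6 * p) * (p + 1) := by ring
  · refine hupp'.trans ?_
    rw [← mul_div_assoc, le_div_iff₀ (by positivity)]
    calc ((k : ℝ) + 1) * (18 * (p + 1)) * (p + 1) ≤ (k + k) * (18 * (p + 1)) * (p + 1) := by gcongr
      _ = 4 * (k * (9 * (p + 1) ^ 2)) := by ring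
      _ ≤ 4 * n := by gcongr


/-- There exist constants `c, C > 0` and an integer `N` such that for every `n ≥ N` there is
a maximal `K₄`-free graph on `n` vertices that is nearly regular: every vertex has degree
between `c · n^(3/5) · (log n)^(1/5)` and `C · n^(3/5) · (log n)^(1/5)`, and in particular
the number of edges lies between `(c/2) · n^(8/5) · (log n)^(1/5)` and
`(C/2) · n^(8/5) · (log n)^(1/5)`. -/
theorem exists_maximal_K4_free_nearly_regular :
    ∃ c C : ℝ, ∃ N : ℕ, 0 < c ∧ 0 < C ∧ ∀ n : ℕ, N ≤ n →
      ∃ G : SimpleGraph (Fin n),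
        G.CliqueFree 4 ∧
        (∀ a b : Fin n, a ≠ b → ¬ G.Adj a b →
          ¬ (G ⊔ SimpleGraph.fromEdgeSet {s(a, b)}).CliqueFree 4) ∧
        (∀ v : Fin n,
          c * (n : ℝ) ^ ((3 : ℝ) / 5) * (Real.log n) ^ ((1 : ℝ) / 5) ≤ ((G.neighborSet v).ncard : ℝ) ∧
          ((G.neighborSet v).ncard : ℝ) ≤ C * (n : ℝ) ^ ((3 : ℝ) / 5) * (Real.log n) ^ ((1 : ℝ) / 5)) ∧
        (c / 2) * (n : ℝ) ^ ((8 : ℝ) / 5) * (Real.log n) ^ ((1 : ℝ) / 5) ≤ (G.edgeSet.ncard : ℝ) ∧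
        (G.edgeSet.ncard : ℝ) ≤ (C / 2) * (n : ℝ) ^ ((8 : ℝ) / 5) * (Real.log n) ^ ((1 : ℝ) / 5) := by
  refine ⟨1 / 6, 8, 59049, by norm_num, by norm_num, fun n hn => ?_⟩
  obtain ⟨q, hq, hqn, hupp, hlow⟩ := exists_board_size hn
  obtain ⟨G, hfree, hmax, hdeg⟩ := exists_maximal_K4_free_of_card (by omega) hqn
  have hn0 : (0 : ℝ) < n := by exact_mod_cast (by omega : 0 < n)
  have hpow : (n : ℝ) ^ ((8 : ℝ) / 5) = n * (n : ℝ) ^ ((3 : ℝ) / 5) := by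
    rw [← Real.rpow_one_add' hn0.le (by norm_num)]; norm_num
  have hdeg' (v : Fin n) :
      1 / 6 * (n : ℝ) ^ ((3 : ℝ) / 5) * Real.log n ^ ((1 : ℝ) / 5) ≤ (G.neighborSet v).ncard ∧
      ((G.neighborSet v).ncard : ℝ) ≤
        8 * (n : ℝ) ^ ((3 : ℝ) / 5) * Real.log n ^ ((1 : ℝ) / 5) := by
    have h := board_degree_bounds hq hqn (hdeg v).1 (hdeg v).2
    constructor <;> linarith [h.1, h.2]
  have hsum : 2 * (G.edgeSet.ncard : ℝ) = ∑ v, ((G.neighborSet v).ncard : ℝ) := by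
    exact_mod_cast two_mul_ncard_edgeSet_eq_sum_ncard_neighborSet G
  have hlo := Finset.card_nsmul_le_sum Finset.univ _ _ fun v _ => (hdeg' v).1
  have hhi := Finset.sum_le_card_nsmul Finset.univ _ _ fun v _ => (hdeg' v).2
  rw [← hsum, Finset.card_univ, Fintype.card_fin, nsmul_eq_mul] at hlo hhi
  refine ⟨G, hfree, hmax, hdeg', ?_, ?_⟩ <;> rw [hpow] <;> linarith
end

section
/- Let (Ω, 𝒜, P) be a probability space, X a finite set, E : Ω → Set(X) a random subset such that for every α ⊆ X the event {ω : α ⊆ E(ω)} is measurable, and let 𝒢 be a measurable event. Let ℓ ≥ 1 be an integer, let S be a nonempty finite family of ℓ-element subsets of X, and let q > 0 be a real number such that for every integer r ≥ 1 and all pairwise disjoint α_1, …, α_r ∈ S one has P[𝒢 ∩ {α_1 ∪ ⋯ ∪ α_r ⊆ E}] ≤ q^(ℓ·r). Set μ' := |S|·q^ℓ. For reals d, k > 0 let DL(d,k) denote the event that there exists I_0 ⊆ S with |I_0| ≤ d such that, setting E_0 := ⋃_{α ∈ I_0} α, at most μ' + k elements α ∈ S satisfy α ⊆ E(ω) \ E_0.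 Then P[𝒢 ∩ ¬DL(d,k)] ≤ (1 + k/μ')^(−d), and consequently P[𝒢 ∩ ¬DL(d,k)] ≤ exp(−d·k/(μ' + k)). -/
open MeasureTheory

/-- The deletion event `DL(d,k)`: there is a subfamily `I₀ ⊆ S` of size at most `d` such
that, deleting the elements `E₀ = ⋃ I₀`, at most `μ' + k` members of `S` are contained in
`E(ω) \ E₀`. -/
def deletionEvent {Ω α : Type*} (E : Ω → Set α) (S : Finset (Finset α))
    (μ' d k : ℝ) : Set Ω :=
  {ω | ∃ I₀ : Finset (Finset α), I₀ ⊆ S ∧ (I₀.card : ℝ) ≤ d ∧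
    (({A : Finset α | A ∈ S ∧ (↑A : Set α) ⊆ E ω \ (⋃ B ∈ I₀, (↑B : Set α))}).ncard : ℝ)
      ≤ μ' + k}

/-- The `n`-tuples of pairwise disjoint members of a family of finite sets. -/
def disjointTuples {α : Type*} [Fintype α] [DecidableEq α]
    (F : Finset (Finset α)) (n : ℕ) : Finset (Fin n → Finset α) :=
  {g | (∀ i, g i ∈ F) ∧ ∀ i j, i ≠ j → Disjoint (g i) (g j)}

/-- If every subfamily of fewer than `n` members of `F` leaves at least `c` members of `F`
disjoint from all of it, then a greedy choice yields at least `c ^ n` disjoint `n`-tuples. -/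
lemma pow_le_card_disjointTuples {α : Type*} [Fintype α] [DecidableEq α]
    (F : Finset (Finset α)) {c : ℝ} (hc : 0 ≤ c) (n : ℕ)
    (h : ∀ I : Finset (Finset α), I ⊆ F → I.card < n →
      c ≤ ((F.filter fun A => ∀ B ∈ I, Disjoint A B).card : ℝ)) :
    c ^ n ≤ ((disjointTuples F n).card : ℝ) := by
  induction n with
  | zero => simp [disjointTuples]
  | succ n ih =>
    have ih' := ih fun I hI hn => h I hI (by omega)
    set ext : (Fin n → Finset α) → Finset (Finset α) := fun g =>
      F.filter fun A => ∀ B ∈ Finset.univ.image g, Disjoint A B with hext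
    have hcard : ((disjointTuples F n).sigma ext).card ≤ (disjointTuples F (n + 1)).card := by
      refine Finset.card_le_card_of_injOn
        (fun p => (Fin.cons p.2 p.1 : Fin (n + 1) → Finset α)) ?_ ?_
      · rintro ⟨g, A⟩ hp
        simp only [disjointTuples, hext, Finset.coe_sigma, Set.mem_sigma_iff, Finset.mem_coe,
          Finset.mem_filter, Finset.mem_univ, true_and, Finset.mem_image,
          forall_exists_index, forall_apply_eq_imp_iff] at hp ⊢
        obtain ⟨⟨hgF, hgd⟩, hAF, hAd⟩ := hp
        refine ⟨fun i => ?_, fun i j hij => ?_⟩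
        · cases i using Fin.cases <;> simp [hAF, hgF]
        · cases i using Fin.cases with
          | zero =>
            cases j using Fin.cases with
            | zero => exact absurd rfl hij
            | succ j => simpa using hAd j
          | succ i =>
            cases j using Fin.cases with
            | zero => simpa using (hAd i).symm
            | succ j => simpa using hgd i j fun e => hij (e ▸ rfl)
      · rintro ⟨g, A⟩ - ⟨g', A'⟩ - hp
        obtain ⟨rfl, rfl⟩ := Fin.cons_injective2 hp
        rfl
    have hfiber : ∀ g ∈ disjointTuples F n, c ≤ ((ext g).card : ℝ) := by
      intro g hg
      simp only [disjointTuples, Finset.mem_filter, Finset.mem_univ, true_and] at hg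
      refine h _ (by simpa [Finset.image_subset_iff] using hg.1) ?_
      have := Finset.card_image_le (s := Finset.univ) (f := g)
      simp only [Finset.card_univ, Fintype.card_fin] at this
      omega
    calc c ^ (n + 1) = c ^ n * c := pow_succ c n
      _ ≤ (disjointTuples F n).card * c := by gcongr
      _ = ∑ _g ∈ disjointTuples F n, c := by simp
      _ ≤ ∑ g ∈ disjointTuples F n, ((ext g).card : ℝ) := Finset.sum_le_sum hfiber
      _ = (((disjointTuples F n).sigma ext).card : ℝ) := by simp [Finset.card_sigma]
      _ ≤ _ := by exact_mod_cast hcard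

lemma card_disjointTuples_le {α : Type*} [Fintype α] [DecidableEq α]
    (F : Finset (Finset α)) (n : ℕ) : (disjointTuples F n).card ≤ F.card ^ n := by
  calc (disjointTuples F n).card ≤ (Fintype.piFinset fun _ : Fin n => F).card :=
        Finset.card_le_card fun g hg => by
          simp only [disjointTuples, Finset.mem_filter] at hg
          simpa using hg.2.1
    _ = F.card ^ n := by simp

open Classical in
/-- Off the deletion event there are many disjoint tuples of members of `S` inside `E ω`. -/
lemma pow_le_card_of_notMem_deletionEvent {Ω α : Type*} [Fintype α] [DecidableEq α]
    {E : Ω → Set α} {S : Finset (Finset α)} {μ' d k : ℝ} (hμ : 0 ≤ μ' + k) (hd : 0 ≤ d)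
    {ω : Ω} (hω : ω ∉ deletionEvent E S μ' d k) :
    (μ' + k) ^ (⌊d⌋₊ + 1) ≤
      (((disjointTuples S (⌊d⌋₊ + 1)).filter
        fun g => (⋃ i, (↑(g i) : Set α)) ⊆ E ω).card : ℝ) := by
  set F : Finset (Finset α) := S.filter fun A => (↑A : Set α) ⊆ E ω with hF
  refine (pow_le_card_disjointTuples F hμ _ fun I hI hn => ?_).trans ?_
  · have hIS : I ⊆ S := hI.trans (Finset.filter_subset _ _)
    have hId : (I.card : ℝ) ≤ d := (Nat.le_floor_iff hd).1 (Nat.lt_succ_iff.1 hn)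
    have hlt : μ' + k < (({A : Finset α | A ∈ S ∧
        (↑A : Set α) ⊆ E ω \ (⋃ B ∈ I, (↑B : Set α))}).ncard : ℝ) := by
      by_contra hle
      exact hω ⟨I, hIS, hId, not_lt.1 hle⟩
    have heq : {A : Finset α | A ∈ S ∧ (↑A : Set α) ⊆ E ω \ (⋃ B ∈ I, (↑B : Set α))} =
        ↑(F.filter fun A => ∀ B ∈ I, Disjoint A B) := by
      ext A
      simp [hF, Set.subset_sdiff, and_assoc]
    rw [heq, Set.ncard_coe_finset] at hlt
    exact hlt.le
  · refine Nat.cast_le.2 (Finset.card_le_card fun g hg => ?_)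
    simp only [disjointTuples, hF, Finset.mem_filter, Finset.mem_univ, true_and] at hg ⊢
    exact ⟨⟨fun i => (hg.1 i).1, hg.2⟩, Set.iUnion_subset fun i => (hg.1 i).2⟩

/-- Markov's inequality for the number of events of a finite family that occur. -/
lemma mul_measure_toReal_le_sum {Ω ι : Type*} [MeasurableSpace Ω] (P : Measure Ω)
    [IsFiniteMeasure P] (T : Finset ι) (U : ι → Set Ω) (hU : ∀ i, MeasurableSet (U i))
    (B : Set Ω) {c : ℝ} (hc : 0 ≤ c)
    (hB : ∀ ω ∈ B, c ≤ ∑ i ∈ T, (U i).indicator (fun _ => (1 : ℝ)) ω) :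
    c * (P B).toReal ≤ ∑ i ∈ T, (P (U i)).toReal := by
  set f : Ω → ℝ := fun ω => ∑ i ∈ T, (U i).indicator (fun _ => (1 : ℝ)) ω
  have hint : ∀ i ∈ T, Integrable ((U i).indicator (fun _ => (1 : ℝ))) P := fun i _ =>
    (integrable_const _).indicator (hU i)
  have hf : 0 ≤ᵐ[P] f := Filter.Eventually.of_forall fun ω =>
    Finset.sum_nonneg fun i _ => Set.indicator_nonneg (fun _ _ => zero_le_one) _
  have hmarkov := mul_meas_ge_le_integral_of_nonneg hf (integrable_finsetSum _ hint) c
  have hsum : ∫ ω, f ω ∂P = ∑ i ∈ T, (P (U i)).toReal := by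
    rw [integral_finsetSum _ hint]
    refine Finset.sum_congr rfl fun i _ => ?_
    rw [integral_indicator_const _ (hU i)]
    simp [Measure.real]
  rw [hsum] at hmarkov
  refine le_trans (mul_le_mul_of_nonneg_left ?_ hc) hmarkov
  exact ENNReal.toReal_mono (measure_ne_top _ _) (measure_mono hB)

lemma one_add_div_rpow_neg_le_exp {m k d : ℝ} (hm : 0 < m) (hk : 0 ≤ k) (hd : 0 ≤ d) :
    (1 + k / m) ^ (-d) ≤ Real.exp (-(d * k) / (m + k)) := by
  have hpos : 0 < 1 + k / m := by positivity
  rw [Real.rpow_def_of_pos hpos, Real.exp_le_exp]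
  have hlog := Real.one_sub_inv_le_log_of_pos hpos
  have heq : 1 - (1 + k / m)⁻¹ = k / (m + k) := by
    field_simp
    ring
  rw [heq] at hlog
  have := mul_le_mul_of_nonneg_left hlog hd
  calc Real.log (1 + k / m) * -d = -(d * Real.log (1 + k / m)) := by ring
    _ ≤ -(d * (k / (m + k))) := neg_le_neg this
    _ = -(d * k) / (m + k) := by ring

/-- Abstract Deletion Lemma: if every collection of pairwise disjoint members of `S`
(each of size `ℓ`) is contained in the random set `E` together with the event `𝒢` with
probability at most `q^(ℓ·r)`, then the probability that `𝒢` holds and the deletion event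
`DL(d,k)` fails is at most `(1 + k/μ')^(−d) ≤ exp(−d·k/(μ'+k))`, where `μ' = |S|·q^ℓ`. -/
theorem deletion_lemma
    {Ω : Type*} [MeasurableSpace Ω] (P : Measure Ω) [IsProbabilityMeasure P]
    {α : Type*} [Fintype α] [DecidableEq α]
    (E : Ω → Set α) (hE : ∀ A : Set α, MeasurableSet {ω | A ⊆ E ω})
    (𝒢 : Set Ω) (h𝒢 : MeasurableSet 𝒢)
    (ℓ : ℕ) (hℓ : 1 ≤ ℓ)
    (S : Finset (Finset α)) (hSne : S.Nonempty) (hScard : ∀ A ∈ S, A.card = ℓ)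
    (q : ℝ) (hq : 0 < q)
    (hP : ∀ r : ℕ, 1 ≤ r → ∀ g : Fin r → Finset α, (∀ i, g i ∈ S) →
      (∀ i j, i ≠ j → Disjoint (g i) (g j)) →
      (P (𝒢 ∩ {ω | (⋃ i, (↑(g i) : Set α)) ⊆ E ω})).toReal ≤ q ^ (ℓ * r))
    (d k : ℝ) (hd : 0 < d) (hk : 0 < k) :
    (P (𝒢 ∩ (deletionEvent E S ((S.card : ℝ) * q ^ ℓ) d k)ᶜ)).toReal
        ≤ (1 + k / ((S.card : ℝ) * q ^ ℓ)) ^ (-d) ∧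
      (P (𝒢 ∩ (deletionEvent E S ((S.card : ℝ) * q ^ ℓ) d k)ᶜ)).toReal
        ≤ Real.exp (-(d * k) / ((S.card : ℝ) * q ^ ℓ + k)) := by
  classical
  set m : ℝ := (S.card : ℝ) * q ^ ℓ with hm
  have hm0 : 0 < m := by
    have : (0 : ℝ) < S.card := by exact_mod_cast hSne.card_pos
    positivity
  have hmk : 0 < m + k := by positivity
  set r := ⌊d⌋₊ + 1 with hr
  set T := disjointTuples S r
  set U : (Fin r → Finset α) → Set Ω := fun g => 𝒢 ∩ {ω | (⋃ i, (↑(g i) : Set α)) ⊆ E ω}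
  have hmarkov : (m + k) ^ r * (P (𝒢 ∩ (deletionEvent E S m d k)ᶜ)).toReal ≤
      ∑ g ∈ T, (P (U g)).toReal := by
    refine mul_measure_toReal_le_sum P T U (fun g => h𝒢.inter (hE _)) _ (by positivity) ?_
    rintro ω ⟨hω𝒢, hω⟩
    refine (pow_le_card_of_notMem_deletionEvent hmk.le hd.le hω).trans (le_of_eq ?_)
    simp [U, Set.indicator_apply, hω𝒢, T, r]
  have hsum : ∑ g ∈ T, (P (U g)).toReal ≤ m ^ r := by
    calc ∑ g ∈ T, (P (U g)).toReal ≤ ∑ _g ∈ T, q ^ (ℓ * r) := by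
          refine Finset.sum_le_sum fun g hg => ?_
          simp only [T, disjointTuples, Finset.mem_filter] at hg
          exact hP r (by omega) g hg.2.1 hg.2.2
      _ = T.card * q ^ (ℓ * r) := by simp
      _ ≤ (S.card : ℝ) ^ r * q ^ (ℓ * r) := by
          gcongr
          exact_mod_cast card_disjointTuples_le S r
      _ = m ^ r := by rw [hm, mul_pow, pow_mul]
  have hmain : (P (𝒢 ∩ (deletionEvent E S m d k)ᶜ)).toReal ≤ (1 + k / m) ^ (-d) := by
    calc (P (𝒢 ∩ (deletionEvent E S m d k)ᶜ)).toReal ≤ m ^ r / (m + k) ^ r := by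
          rw [le_div_iff₀' (by positivity)]
          exact hmarkov.trans hsum
      _ = (1 + k / m) ^ (-(r : ℝ)) := by
          rw [Real.rpow_neg (by positivity), Real.rpow_natCast, ← div_pow, ← inv_pow]
          congr 1
          field_simp
      _ ≤ (1 + k / m) ^ (-d) := by
          refine Real.rpow_le_rpow_of_exponent_le (by simp; positivity) (neg_le_neg ?_)
          have := Nat.lt_floor_add_one d
          rw [hr]
          push_cast
          exact this.le
  exact ⟨hmain, hmain.trans (one_add_div_rpow_neg_le_exp hm0 hk.le hd.le)⟩
end
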